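/- Let u₀ : ℝⁿ → ℝ be a locally Lipschitz function with u₀(x) → +∞ as |x| → +∞ (a proper entire graph). Let u₁, u₂ : ℝⁿ × (0,T] → ℝ be two smooth solutions of the graphical mean curvature flow which both satisfy the curvature condition with the same constant c > 0, and which both attain the initial data u₀, i.e., uᵢ(·,t) → u₀ locally uniformly as t → 0⁺ for i = 1,2. Then u₁ = u₂ on ℝⁿ × (0,T]. -/

import Mathlib

open Real Filter Set

noncomputable section

/-- The `i`-th spatial partial derivative of `f : ℝⁿ → ℝ`. -/
def pd (n : ℕ) (f : EuclideanSpace ℝ (Fin n) → ℝ) (i : Fin n)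
    (x : EuclideanSpace ℝ (Fin n)) : ℝ :=
  fderiv ℝ f x (EuclideanSpace.single i 1)

/-- The second spatial partial derivative `∂ᵢ∂ⱼ f`. -/
def pd2 (n : ℕ) (f : EuclideanSpace ℝ (Fin n) → ℝ) (i j : Fin n)
    (x : EuclideanSpace ℝ (Fin n)) : ℝ :=
  pd n (fun y => pd n f j y) i x

/-- The squared norm `|Df|²` of the spatial gradient. -/
def gradSq (n : ℕ) (f : EuclideanSpace ℝ (Fin n) → ℝ)
    (x : EuclideanSpace ℝ (Fin n)) : ℝ :=
  ∑ i, (pd n f i x) ^ 2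

/-- The right-hand side of the graphical mean curvature flow equation:
`Σ_{i,j} (δ_{ij} − ∂ᵢf ∂ⱼf/(1+|Df|²)) ∂ᵢ∂ⱼf`. -/
def mcfRHS (n : ℕ) (f : EuclideanSpace ℝ (Fin n) → ℝ)
    (x : EuclideanSpace ℝ (Fin n)) : ℝ :=
  ∑ i, ∑ j, ((if i = j then (1 : ℝ) else 0)
    - pd n f i x * pd n f j x / (1 + gradSq n f x)) * pd2 n f i j x

/-- `u : ℝⁿ × S → ℝ` (curried, space then time) solves the graphical mean
curvature flow on the time set `S`. -/
def IsMCFSolution (n : ℕ) (u : EuclideanSpace ℝ (Fin n) → ℝ → ℝ) (S : Set ℝ) : Prop :=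
  ∀ x, ∀ t ∈ S, deriv (fun s => u x s) t = mcfRHS n (fun y => u y t) x

/-- The curvature condition `v hⁱⱼ ≥ −c δⁱⱼ` for the graph of `u(·,t)`:
`Σ_{i,j} (Σ_l (δ_{il} − ∂ᵢu ∂ₗu/(1+|Du|²)) ∂ₗ∂ⱼu) ξᵢ ξⱼ ≥ −c |ξ|²` for all `ξ`. -/
def CurvCond (n : ℕ) (u : EuclideanSpace ℝ (Fin n) → ℝ → ℝ) (S : Set ℝ) (c : ℝ) : Prop :=
  ∀ x, ∀ t ∈ S, ∀ ξ : Fin n → ℝ,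
    ∑ i, ∑ j, (∑ l, ((if i = l then (1 : ℝ) else 0)
        - pd n (fun y => u y t) i x * pd n (fun y => u y t) l x
          / (1 + gradSq n (fun y => u y t) x))
      * pd2 n (fun y => u y t) l j x) * ξ i * ξ j ≥ -c * ∑ i, (ξ i) ^ 2

lemma fderiv_apply_eq_sum_pd (n : ℕ) (f : EuclideanSpace ℝ (Fin n) → ℝ)
    (x ξ : EuclideanSpace ℝ (Fin n)) :
    fderiv ℝ f x ξ = ∑ i, ξ i * pd n f i x := by
  have h : ξ = ∑ i, ξ i • EuclideanSpace.single i (1 : ℝ) := by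
    ext j
    simp [Finset.sum_apply, Pi.single_apply]
  conv_lhs => rw [h]
  simp [pd, map_sum]

lemma contDiff_pd {n : ℕ} {f : EuclideanSpace ℝ (Fin n) → ℝ}
    (hf : ContDiff ℝ (⊤ : ℕ∞) f) (i : Fin n) : ContDiff ℝ (⊤ : ℕ∞) (pd n f i) :=
  (hf.fderiv_right (m := (⊤ : ℕ∞)) (by simp)).clm_apply contDiff_const

lemma hasDerivAt_comp_line {n : ℕ} {f : EuclideanSpace ℝ (Fin n) → ℝ}
    (hf : ContDiff ℝ (⊤ : ℕ∞) f) (x ξ : EuclideanSpace ℝ (Fin n)) (s : ℝ) :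
    HasDerivAt (fun s : ℝ => f (x + s • ξ)) (∑ i, ξ i * pd n f i (x + s • ξ)) s := by
  rw [← fderiv_apply_eq_sum_pd]
  have h1 : HasDerivAt (fun s : ℝ => x + s • ξ) ξ s := by
    simpa using ((hasDerivAt_id s).smul_const ξ).const_add x
  exact ((hf.differentiable (by simp)) (x + s • ξ)).hasFDerivAt.comp_hasDerivAt s h1

lemma hasDerivAt_deriv_comp_line {n : ℕ} {f : EuclideanSpace ℝ (Fin n) → ℝ}
    (hf : ContDiff ℝ (⊤ : ℕ∞) f) (x ξ : EuclideanSpace ℝ (Fin n)) (s : ℝ) :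
    HasDerivAt (fun s : ℝ => ∑ i, ξ i * pd n f i (x + s • ξ))
      (∑ i, ∑ j, ξ i * ξ j * pd2 n f i j (x + s • ξ)) s := by
  rw [Finset.sum_comm]
  refine HasDerivAt.fun_sum fun i _ => ?_
  refine ((hasDerivAt_comp_line (contDiff_pd hf i) x ξ s).const_mul (ξ i)).congr_deriv ?_
  rw [Finset.mul_sum]
  exact Finset.sum_congr rfl fun j _ => by rw [pd2]; ring

lemma nonpos_of_isLocalMax_of_hasDerivAt {h h' : ℝ → ℝ} {a h'' : ℝ}
    (hmax : IsLocalMax h a) (h1 : ∀ s, HasDerivAt h (h' s) s) (h2 : HasDerivAt h' h'' a) :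
    h'' ≤ 0 := by
  by_contra! hpos
  have hd : deriv h = h' := funext fun s => (h1 s).deriv
  have hmin : IsLocalMin h a := by
    refine isLocalMin_of_deriv_deriv_pos ?_ hmax.deriv_eq_zero (h1 a).continuousAt
    rw [hd, h2.deriv]
    exact hpos
  have hconst : h =ᶠ[nhds a] fun _ => h a := by
    filter_upwards [hmax, hmin] with s hs hs' using le_antisymm hs hs'
  have h0 := hconst.deriv.deriv_eq
  rw [hd, h2.deriv] at h0
  simp at h0
  linarith

/-- First and second order conditions at a spatial maximum of `e^{-g} - e^{-f}`. -/
lemma isLocalMax_exp_neg_sub {n : ℕ} {f g : EuclideanSpace ℝ (Fin n) → ℝ}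
    (hf : ContDiff ℝ (⊤ : ℕ∞) f) (hg : ContDiff ℝ (⊤ : ℕ∞) g)
    {x : EuclideanSpace ℝ (Fin n)}
    (hmax : IsLocalMax (fun y => exp (-g y) - exp (-f y)) x)
    (ξ : EuclideanSpace ℝ (Fin n)) :
    exp (-f x) * ∑ i, ξ i * pd n f i x = exp (-g x) * ∑ i, ξ i * pd n g i x ∧
    exp (-f x) * ((∑ i, ∑ j, ξ i * ξ j * pd2 n f i j x) - (∑ i, ξ i * pd n f i x) ^ 2) ≤
      exp (-g x) * ((∑ i, ∑ j, ξ i * ξ j * pd2 n g i j x) - (∑ i, ξ i * pd n g i x) ^ 2) := by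
  have hf1 := fun s => hasDerivAt_comp_line hf x ξ s
  have hg1 := fun s => hasDerivAt_comp_line hg x ξ s
  have hf2 := hasDerivAt_deriv_comp_line hf x ξ 0
  have hg2 := hasDerivAt_deriv_comp_line hg x ξ 0
  have hline : IsLocalMax (fun s : ℝ => exp (-g (x + s • ξ)) - exp (-f (x + s • ξ))) 0 := by
    have hc : ContinuousAt (fun s : ℝ => x + s • ξ) 0 := by fun_prop
    have := hc.tendsto.eventually (p := fun y => exp (-g y) - exp (-f y) ≤
      exp (-g x) - exp (-f x)) (by rw [zero_smul, add_zero]; exact hmax)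
    simpa [IsLocalMax, IsMaxFilter] using this
  have h1 := fun s => (hg1 s).fun_neg.exp.fun_sub (hf1 s).fun_neg.exp
  have h2 := ((hg1 0).fun_neg.exp.fun_mul hg2.fun_neg).fun_sub
    ((hf1 0).fun_neg.exp.fun_mul hf2.fun_neg)
  have e1 := hline.hasDerivAt_eq_zero (h1 0)
  have e2 := nonpos_of_isLocalMax_of_hasDerivAt hline h1 h2
  simp only [zero_smul, add_zero] at e1 e2
  constructor
  · linarith
  · linarith

/-- The trace of a negative semidefinite form against `I - p ⊗ p / (1 + |p|²)` is nonpositive. -/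
lemma trace_mul_nonpos {n : ℕ} (p : Fin n → ℝ) (H : Fin n → Fin n → ℝ)
    (hH : ∀ ξ : Fin n → ℝ, ∑ i, ∑ j, ξ i * ξ j * H i j ≤ 0) :
    ∑ i, H i i - (∑ i, ∑ j, p i * p j * H i j) / (1 + ∑ i, p i ^ 2) ≤ 0 := by
  set q := ∑ i, p i ^ 2 with hq
  set Q := ∑ i, ∑ j, p i * p j * H i j with hQ
  have hq0 : 0 ≤ q := Finset.sum_nonneg fun i _ => sq_nonneg _
  set v := √(1 + q) with hv
  have hv2 : v ^ 2 = 1 + q := Real.sq_sqrt (by linarith)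
  have hv0 : 0 < v := Real.sqrt_pos.2 (by linarith)
  set a := 1 / (v * (v + 1)) with ha
  have key : ∀ k, ∑ i, ∑ j, ((if i = k then 1 else 0) - a * p k * p i) *
      ((if j = k then 1 else 0) - a * p k * p j) * H i j =
      H k k - a * (∑ j, p k * p j * H k j) - a * (∑ i, p i * p k * H i k)
        + a ^ 2 * p k ^ 2 * Q := by
    intro k
    have : ∀ i j, ((if i = k then 1 else 0) - a * p k * p i) *
      ((if j = k then 1 else 0) - a * p k * p j) * H i j =
      (if i = k then (if j = k then H i j else 0) else 0)
      - (if i = k then a * (p k * p j * H i j) else 0)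
      - (if j = k then a * (p i * p k * H i j) else 0)
      + a ^ 2 * p k ^ 2 * (p i * p j * H i j) := by
      intro i j
      split_ifs <;> ring
    simp only [this, Finset.sum_add_distrib, Finset.sum_sub_distrib, ← Finset.mul_sum, hQ]
    congr 1
    congr 1
    · congr 1
      · simp
      · rw [Finset.sum_comm]; simp [Finset.mul_sum]
    · simp [Finset.mul_sum]
  have hsum := Finset.sum_nonpos fun k (_ : k ∈ Finset.univ) =>
    (key k).symm.le.trans (hH fun i => (if i = k then 1 else 0) - a * p k * p i)
  have hQ' : ∑ k, ∑ i, p i * p k * H i k = Q := Finset.sum_comm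
  rw [Finset.sum_add_distrib, Finset.sum_sub_distrib, Finset.sum_sub_distrib,
    ← Finset.mul_sum, ← Finset.mul_sum, hQ', ← Finset.sum_mul, ← Finset.mul_sum, ← hq] at hsum
  have hav : 2 * a - a ^ 2 * q = 1 / (1 + q) := by
    have : q = v ^ 2 - 1 := by linarith
    rw [← hv2, this, ha]
    field_simp
    ring
  calc _ = ∑ i, H i i - (1 / (1 + q)) * Q := by ring
    _ ≤ 0 := by rw [← hav]; linarith

lemma mcfRHS_eq (n : ℕ) (f : EuclideanSpace ℝ (Fin n) → ℝ) (x : EuclideanSpace ℝ (Fin n)) :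
    mcfRHS n f x = ∑ i, pd2 n f i i x -
      (∑ i, ∑ j, pd n f i x * pd n f j x * pd2 n f i j x) / (1 + gradSq n f x) := by
  simp only [mcfRHS, sub_mul, Finset.sum_sub_distrib, Finset.sum_div]
  congr 1
  · simp
  · exact Finset.sum_congr rfl fun i _ => Finset.sum_congr rfl fun j _ => by ring

lemma gradSq_nonneg (n : ℕ) (f : EuclideanSpace ℝ (Fin n) → ℝ) (x : EuclideanSpace ℝ (Fin n)) :
    0 ≤ gradSq n f x := Finset.sum_nonneg fun _ _ => sq_nonneg _

section CurvCond

variable {n : ℕ} {u : EuclideanSpace ℝ (Fin n) → ℝ → ℝ} {S : Set ℝ} {c : ℝ}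

lemma CurvCond.hessian_grad_ge (h : CurvCond n u S c) (x : EuclideanSpace ℝ (Fin n))
    {t : ℝ} (ht : t ∈ S) :
    -c * gradSq n (fun y => u y t) x * (1 + gradSq n (fun y => u y t) x) ≤
      ∑ i, ∑ j, pd n (fun y => u y t) i x * pd n (fun y => u y t) j x *
        pd2 n (fun y => u y t) i j x := by
  have h1 := h x t ht fun i => pd n (fun y => u y t) i x
  set p := fun i => pd n (fun y => u y t) i x
  set H := fun i j => pd2 n (fun y => u y t) i j x
  change _ ≥ -c * gradSq n (fun y => u y t) x at h1
  set q := gradSq n (fun y => u y t) x with hq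
  change -c * q * (1 + q) ≤ ∑ i, ∑ j, p i * p j * H i j
  change ∑ i, ∑ j, (∑ l, ((if i = l then (1 : ℝ) else 0) - p i * p l / (1 + q)) * H l j)
    * p i * p j ≥ -c * q at h1
  have hq0 : 0 ≤ q := gradSq_nonneg _ _ _
  have hqs : ∑ i, p i ^ 2 = q := rfl
  have e : ∀ i j, (∑ l, ((if i = l then (1 : ℝ) else 0) - p i * p l / (1 + q)) * H l j)
      * p i * p j = p i * p j * H i j - p i ^ 2 * ((∑ l, p l * p j * H l j) / (1 + q)) := by
    intro i j
    simp only [sub_mul, Finset.sum_sub_distrib, Finset.sum_div, Finset.mul_sum, Finset.sum_mul]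
    congr 1
    · simp; ring
    · exact Finset.sum_congr rfl fun l _ => by ring
  have e2 : ∑ j, ∑ l, p l * p j * H l j = ∑ i, ∑ j, p i * p j * H i j := Finset.sum_comm
  simp only [e, Finset.sum_sub_distrib, ← Finset.mul_sum, ← Finset.sum_mul,
    ← Finset.sum_div] at h1
  rw [e2, hqs] at h1
  set Q := ∑ i, ∑ j, p i * p j * H i j
  have h2 : Q - q * (Q / (1 + q)) = Q / (1 + q) := by field_simp; ring
  rw [h2, ge_iff_le, le_div_iff₀ (by linarith)] at h1
  exact h1

lemma CurvCond.mcfRHS_ge (h : CurvCond n u S c) (x : EuclideanSpace ℝ (Fin n))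
    {t : ℝ} (ht : t ∈ S) : -(n * c) ≤ mcfRHS n (fun y => u y t) x := by
  have h1 : ∀ k, -c ≤ ∑ l, ((if k = l then (1 : ℝ) else 0) -
      pd n (fun y => u y t) k x * pd n (fun y => u y t) l x / (1 + gradSq n (fun y => u y t) x))
      * pd2 n (fun y => u y t) l k x := by
    intro k
    simpa [ite_pow] using h x t ht fun i => if i = k then 1 else 0
  have h2 := Finset.sum_le_sum fun k (_ : k ∈ Finset.univ) => h1 k
  rw [Finset.sum_const, Finset.card_univ, Fintype.card_fin, Finset.sum_comm] at h2
  refine le_trans (by simp) (h2.trans_eq ?_)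
  rw [mcfRHS]
  refine Finset.sum_congr rfl fun i _ => Finset.sum_congr rfl fun j _ => ?_
  simp only [eq_comm (a := i), mul_comm (pd n (fun y => u y t) i x)]

end CurvCond

lemma exp_diff_le_aux {c E₁ E₂ q Q : ℝ} (hc : 0 ≤ c) (hE₁ : 0 < E₁) (hE : E₁ ≤ E₂)
    (hq : 0 ≤ q) (hQ : -c * q * (1 + q) ≤ Q) :
    E₁ * ((E₂ / E₁) ^ 2 * q / (1 + (E₂ / E₁) ^ 2 * q))
      - E₂ * q / (1 + (E₂ / E₁) ^ 2 * q)
      + E₂ * Q * (1 / (1 + q) - (E₂ / E₁) ^ 2 / (1 + (E₂ / E₁) ^ 2 * q))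
      ≤ (2 * c + 1) * (E₂ - E₁) := by
  have hE₂ : 0 < E₂ := hE₁.trans_le hE
  have hD : 0 < E₁ ^ 2 + E₂ ^ 2 * q := by positivity
  have e1 : E₁ * ((E₂ / E₁) ^ 2 * q / (1 + (E₂ / E₁) ^ 2 * q))
      - E₂ * q / (1 + (E₂ / E₁) ^ 2 * q) =
      E₁ * E₂ * q * (E₂ - E₁) / (E₁ ^ 2 + E₂ ^ 2 * q) := by
    field_simp
  have e2 : E₂ * Q * (1 / (1 + q) - (E₂ / E₁) ^ 2 / (1 + (E₂ / E₁) ^ 2 * q)) =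
      -(Q / (1 + q)) * (E₂ * (E₂ + E₁) * (E₂ - E₁) / (E₁ ^ 2 + E₂ ^ 2 * q)) := by
    field_simp
    ring
  have h3 : -(Q / (1 + q)) ≤ c * q := by
    rw [neg_le, le_div_iff₀ (by linarith)]
    linarith
  have hw : 0 ≤ E₂ - E₁ := by linarith
  rw [e1, e2]
  have h4 : E₁ * E₂ * q * (E₂ - E₁) / (E₁ ^ 2 + E₂ ^ 2 * q) ≤ E₂ - E₁ := by
    rw [div_le_iff₀ hD, mul_comm]
    refine mul_le_mul_of_nonneg_left ?_ hw
    nlinarith [mul_nonneg (mul_nonneg hE₂.le hq) hw, sq_nonneg E₁]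
  have h5 : c * q * (E₂ * (E₂ + E₁) * (E₂ - E₁) / (E₁ ^ 2 + E₂ ^ 2 * q)) ≤
      2 * c * (E₂ - E₁) := by
    rw [← mul_div_assoc, div_le_iff₀ hD]
    have : q * (E₂ * (E₂ + E₁)) ≤ 2 * (E₁ ^ 2 + E₂ ^ 2 * q) := by
      nlinarith [mul_nonneg (mul_nonneg hE₂.le hq) hw, sq_nonneg E₁]
    nlinarith [mul_le_mul_of_nonneg_left this (mul_nonneg hc hw)]
  have h6 := mul_le_mul_of_nonneg_right h3
    (show 0 ≤ E₂ * (E₂ + E₁) * (E₂ - E₁) / (E₁ ^ 2 + E₂ ^ 2 * q) by positivity)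
  linarith

/-- The differential inequality for `e^{-g} - e^{-f}` at a nonnegative spatial maximum. -/
lemma exp_mul_mcfRHS_sub_le {n : ℕ} {f g : EuclideanSpace ℝ (Fin n) → ℝ}
    (hf : ContDiff ℝ (⊤ : ℕ∞) f) (hg : ContDiff ℝ (⊤ : ℕ∞) g)
    {x : EuclideanSpace ℝ (Fin n)} {c : ℝ} (hc : 0 ≤ c)
    (hmax : IsLocalMax (fun y => exp (-g y) - exp (-f y)) x)
    (hpos : exp (-f x) ≤ exp (-g x))
    (hQ : -c * gradSq n g x * (1 + gradSq n g x) ≤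
      ∑ i, ∑ j, pd n g i x * pd n g j x * pd2 n g i j x) :
    exp (-f x) * mcfRHS n f x - exp (-g x) * mcfRHS n g x ≤
      (2 * c + 1) * (exp (-g x) - exp (-f x)) := by
  have h := isLocalMax_exp_neg_sub hf hg hmax
  have hE₁ : 0 < exp (-f x) := exp_pos _
  set E₁ := exp (-f x)
  set E₂ := exp (-g x)
  have hgrad : ∀ i, pd n f i x = E₂ / E₁ * pd n g i x := by
    intro i
    have := (h (EuclideanSpace.single i 1)).1
    simp at this
    field_simp
    linarith
  have htr := trace_mul_nonpos (fun i => pd n f i x)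
    (fun i j => E₁ * (pd2 n f i j x - pd n f i x * pd n f j x)
      - E₂ * (pd2 n g i j x - pd n g i x * pd n g j x)) (by
    intro ξ
    have h2 := (h (WithLp.toLp 2 ξ)).2
    simp only at h2
    have e : ∀ k : EuclideanSpace ℝ (Fin n) → ℝ,
        (∑ i, ∑ j, ξ i * ξ j * pd2 n k i j x) - (∑ i, ξ i * pd n k i x) ^ 2 =
        ∑ i, ∑ j, ξ i * ξ j * (pd2 n k i j x - pd n k i x * pd n k j x) := by
      intro k
      rw [sq, Finset.sum_mul_sum, ← Finset.sum_sub_distrib]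
      refine Finset.sum_congr rfl fun i _ => ?_
      rw [← Finset.sum_sub_distrib]
      exact Finset.sum_congr rfl fun j _ => by ring
    rw [e, e, ← sub_nonpos, Finset.mul_sum, Finset.mul_sum, ← Finset.sum_sub_distrib] at h2
    refine le_trans (le_of_eq ?_) h2
    refine Finset.sum_congr rfl fun i _ => ?_
    rw [Finset.mul_sum, Finset.mul_sum, ← Finset.sum_sub_distrib]
    exact Finset.sum_congr rfl fun j _ => by ring)
  have hqf : gradSq n f x = (E₂ / E₁) ^ 2 * gradSq n g x := by
    simp only [gradSq, hgrad, mul_pow, ← Finset.mul_sum]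
  have e1 : ∑ i, (E₁ * (pd2 n f i i x - pd n f i x * pd n f i x)
      - E₂ * (pd2 n g i i x - pd n g i x * pd n g i x)) =
      E₁ * (∑ i, pd2 n f i i x - gradSq n f x) - E₂ * (∑ i, pd2 n g i i x - gradSq n g x) := by
    simp only [gradSq, Finset.sum_sub_distrib, ← Finset.mul_sum, sq]
  have e2 : ∑ i, ∑ j, pd n f i x * pd n f j x *
      (E₁ * (pd2 n f i j x - pd n f i x * pd n f j x)
      - E₂ * (pd2 n g i j x - pd n g i x * pd n g j x)) =
      E₁ * (∑ i, ∑ j, pd n f i x * pd n f j x * pd2 n f i j x - gradSq n f x ^ 2)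
      - E₂ * (E₂ / E₁) ^ 2 * (∑ i, ∑ j, pd n g i x * pd n g j x * pd2 n g i j x
        - gradSq n g x ^ 2) := by
    have e (k : EuclideanSpace ℝ (Fin n) → ℝ) :
        gradSq n k x ^ 2 = ∑ i, ∑ j, pd n k i x ^ 2 * pd n k j x ^ 2 := by
      rw [gradSq, sq, Finset.sum_mul_sum]
    simp only [e, ← Finset.sum_sub_distrib, Finset.mul_sum]
    refine Finset.sum_congr rfl fun i _ => Finset.sum_congr rfl fun j _ => ?_
    rw [hgrad i, hgrad j]
    ring
  have e3 : ∑ i, pd n f i x ^ 2 = gradSq n f x := rfl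
  rw [e1, e2, e3] at htr
  have hq0 := gradSq_nonneg n g x
  have haux := exp_diff_le_aux hc hE₁ hpos hq0 hQ
  rw [mcfRHS_eq, mcfRHS_eq]
  set Q₁ := ∑ i, ∑ j, pd n f i x * pd n f j x * pd2 n f i j x
  set Q₂ := ∑ i, ∑ j, pd n g i x * pd n g j x * pd2 n g i j x
  set q := gradSq n g x
  rw [hqf] at htr ⊢
  set r := (E₂ / E₁) ^ 2
  have hr : 0 ≤ r := sq_nonneg _
  have hrq : 0 < 1 + r * q := by positivity
  set L₁ := ∑ i, pd2 n f i i x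
  set L₂ := ∑ i, pd2 n g i i x
  have e4 : E₁ * (L₁ - Q₁ / (1 + r * q)) - E₂ * (L₂ - Q₂ / (1 + q)) =
      (E₁ * (L₁ - r * q) - E₂ * (L₂ - q) -
        (E₁ * (Q₁ - (r * q) ^ 2) - E₂ * r * (Q₂ - q ^ 2)) / (1 + r * q)) +
      (E₁ * (r * q / (1 + r * q)) - E₂ * q / (1 + r * q)
        + E₂ * Q₂ * (1 / (1 + q) - r / (1 + r * q))) := by
    field_simp
    ring
  rw [e4]
  linarith

section Flow

variable {n : ℕ} {T c : ℝ} {u₀ : EuclideanSpace ℝ (Fin n) → ℝ}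

lemma contDiff_slice {u : EuclideanSpace ℝ (Fin n) → ℝ → ℝ}
    (hu : ContDiffOn ℝ (⊤ : ℕ∞) (fun p : EuclideanSpace ℝ (Fin n) × ℝ => u p.1 p.2)
      (Set.univ ×ˢ Set.Ioc 0 T)) {t : ℝ} (ht : t ∈ Set.Ioc 0 T) :
    ContDiff ℝ (⊤ : ℕ∞) fun x => u x t :=
  contDiffOn_univ.1 <| hu.comp (f := fun x => (x, t))
    (contDiff_id.prodMk contDiff_const).contDiffOn fun x _ => ⟨mem_univ x, ht⟩

lemma hasDerivAt_time {u : EuclideanSpace ℝ (Fin n) → ℝ → ℝ}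
    (hu : ContDiffOn ℝ (⊤ : ℕ∞) (fun p : EuclideanSpace ℝ (Fin n) × ℝ => u p.1 p.2)
      (Set.univ ×ˢ Set.Ioc 0 T))
    (hflow : IsMCFSolution n u (Set.Ioc 0 T))
    (x : EuclideanSpace ℝ (Fin n)) {t : ℝ} (ht : t ∈ Set.Ioo 0 T) :
    HasDerivAt (u x) (mcfRHS n (fun y => u y t) x) t := by
  have h1 : ContDiffOn ℝ (⊤ : ℕ∞) (u x) (Set.Ioc 0 T) :=
    hu.comp (f := fun s => (x, s)) (contDiff_const.prodMk contDiff_id).contDiffOn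
      fun s hs => ⟨mem_univ x, hs⟩
  have h2 : DifferentiableAt ℝ (u x) t :=
    (h1.contDiffAt (Ioc_mem_nhds ht.1 ht.2)).differentiableAt (by simp)
  rw [← hflow x t (Ioo_subset_Ioc_self ht)]
  exact h2.hasDerivAt

lemma initial_sub_le {u : EuclideanSpace ℝ (Fin n) → ℝ → ℝ}
    (hu : ContDiffOn ℝ (⊤ : ℕ∞) (fun p : EuclideanSpace ℝ (Fin n) × ℝ => u p.1 p.2)
      (Set.univ ×ˢ Set.Ioc 0 T))
    (hflow : IsMCFSolution n u (Set.Ioc 0 T)) (hcurv : CurvCond n u (Set.Ioc 0 T) c)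
    (hinit : TendstoLocallyUniformly (fun t x => u x t) u₀ (nhdsWithin 0 (Set.Ioi 0)))
    (x : EuclideanSpace ℝ (Fin n)) {t : ℝ} (ht : t ∈ Set.Ioo 0 T) :
    u₀ x - n * c * t ≤ u x t := by
  have hd : ∀ s ∈ Ioo 0 T, HasDerivAt (fun s => u x s + n * c * s)
      (mcfRHS n (fun y => u y s) x + n * c) s := fun s hs => by
    simpa using (hasDerivAt_time hu hflow x hs).fun_add ((hasDerivAt_id s).const_mul (n * c))
  have hmono : MonotoneOn (fun s => u x s + n * c * s) (Ioo 0 T) := by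
    refine monotoneOn_of_deriv_nonneg (convex_Ioo 0 T)
      (fun s hs => (hd s hs).continuousAt.continuousWithinAt) ?_ ?_
    · rw [interior_Ioo]
      exact fun s hs => (hd s hs).differentiableAt.differentiableWithinAt
    · rw [interior_Ioo]
      intro s hs
      rw [(hd s hs).deriv]
      linarith [hcurv.mcfRHS_ge x (Ioo_subset_Ioc_self hs)]
  have hlim : Tendsto (fun s => u x s + n * c * s) (nhdsWithin 0 (Ioi 0))
      (nhds (u₀ x + n * c * 0)) :=
    ((tendstoLocallyUniformlyOn_univ.2 hinit).tendsto_at (mem_univ x)).add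
      ((continuous_const_mul _).tendsto' _ _ rfl |>.mono_left nhdsWithin_le_nhds)
  have := le_of_tendsto hlim (b := u x t + n * c * t) (by
    filter_upwards [Ioo_mem_nhdsGT ht.1] with s hs
    exact hmono ⟨hs.1, hs.2.trans ht.2⟩ ht hs.2.le)
  linarith

lemma exp_neg_sub_exp_neg_le (a b : ℝ) : exp (-b) - exp (-a) ≤ exp (-b) * (a - b) := by
  have h : exp (-a) = exp (-b) * exp (b - a) := by rw [← exp_add]; congr 1; ring
  rw [h]
  nlinarith [add_one_le_exp (b - a), exp_pos (-b)]

/-- If `u₀` is proper, `e^{-(u₀ - C)}` is uniformly small outside a compact set. -/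
lemma exists_compact_exp_neg_lt (hproper : Tendsto u₀ (cocompact _) atTop) (C : ℝ)
    {η : ℝ} (hη : 0 < η) :
    ∃ B : Set (EuclideanSpace ℝ (Fin n)), IsCompact B ∧ ∀ x ∉ B, exp (-(u₀ x - C)) < η := by
  have h : ∀ᶠ x in cocompact _, exp (-(u₀ x - C)) < η := by
    filter_upwards [hproper.eventually_gt_atTop (C - log η)] with x hx
    rw [← lt_log_iff_exp_lt hη]
    linarith
  obtain ⟨B, hB, hB'⟩ := mem_cocompact.1 h
  exact ⟨B, hB, fun x hx => hB' hx⟩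

lemma exists_time_exp_neg_sub_lt (hu₀ : Continuous u₀)
    {u₁ u₂ : EuclideanSpace ℝ (Fin n) → ℝ → ℝ}
    (hinit₁ : TendstoLocallyUniformly (fun t x => u₁ x t) u₀ (nhdsWithin 0 (Set.Ioi 0)))
    (hinit₂ : TendstoLocallyUniformly (fun t x => u₂ x t) u₀ (nhdsWithin 0 (Set.Ioi 0)))
    {B : Set (EuclideanSpace ℝ (Fin n))} (hB : IsCompact B) {η : ℝ} (hη : 0 < η) :
    ∃ τ > 0, ∀ t ∈ Set.Ioo 0 τ, ∀ x ∈ B, exp (-u₂ x t) - exp (-u₁ x t) < η := by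
  obtain ⟨m, hm⟩ := (hB.image hu₀).bddBelow
  set A := exp (-(m - 1))
  have hA : 0 < A := exp_pos _
  set δ := min 1 (η / (3 * A))
  have hδ : 0 < δ := by positivity
  have hδ' : A * (2 * δ) < η := by
    have : δ ≤ η / (3 * A) := min_le_right _ _
    rw [le_div_iff₀ (by positivity)] at this
    nlinarith
  have unif {u : EuclideanSpace ℝ (Fin n) → ℝ → ℝ}
      (h : TendstoLocallyUniformly (fun t x => u x t) u₀ (nhdsWithin 0 (Set.Ioi 0))) :=
    Metric.tendstoUniformlyOn_iff.1 ((tendstoLocallyUniformlyOn_iff_tendstoUniformlyOn_of_compact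
      hB).1 h.tendstoLocallyUniformlyOn) δ hδ
  obtain ⟨τ, hτ, hsub⟩ := mem_nhdsGT_iff_exists_Ioo_subset.1 ((unif hinit₁).and (unif hinit₂))
  refine ⟨τ, hτ, fun t ht x hx => ?_⟩
  have h := hsub ht
  have h1 := abs_lt.1 (h.1 x hx)
  have h2 := abs_lt.1 (h.2 x hx)
  have hmx : m ≤ u₀ x := hm ⟨x, hx, rfl⟩
  have hδ1 : δ ≤ 1 := min_le_left _ _
  have hexp : exp (-u₂ x t) ≤ A := exp_le_exp.2 (by linarith)
  calc _ ≤ exp (-u₂ x t) * (u₁ x t - u₂ x t) := exp_neg_sub_exp_neg_le _ _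
    _ ≤ exp (-u₂ x t) * (2 * δ) := by gcongr; linarith
    _ ≤ A * (2 * δ) := by gcongr
    _ < η := hδ'

lemma HasDerivAt.nonneg_of_forall_left_le {F : ℝ → ℝ} {F' a t : ℝ} (hat : a < t)
    (hF : HasDerivAt F F' t) (hle : ∀ s ∈ Set.Ioo a t, F s ≤ F t) : 0 ≤ F' := by
  have h := hasDerivWithinAt_iff_tendsto_slope' self_notMem_Iio |>.1 (hF.hasDerivWithinAt (s := Iio t))
  refine ge_of_tendsto h ?_
  filter_upwards [Ioo_mem_nhdsLT hat] with s hs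
  rw [slope_def_field]
  exact div_nonneg_of_nonpos (by linarith [hle s hs]) (by linarith [hs.2])

lemma mcf_le_of_initial_eq
    (hu₀ : Continuous u₀) (hproper : Tendsto u₀ (cocompact _) atTop)
    {u₁ u₂ : EuclideanSpace ℝ (Fin n) → ℝ → ℝ}
    (hsmooth₁ : ContDiffOn ℝ (⊤ : ℕ∞) (fun p : EuclideanSpace ℝ (Fin n) × ℝ => u₁ p.1 p.2)
      (Set.univ ×ˢ Set.Ioc 0 T))
    (hsmooth₂ : ContDiffOn ℝ (⊤ : ℕ∞) (fun p : EuclideanSpace ℝ (Fin n) × ℝ => u₂ p.1 p.2)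
      (Set.univ ×ˢ Set.Ioc 0 T))
    (hflow₁ : IsMCFSolution n u₁ (Set.Ioc 0 T))
    (hflow₂ : IsMCFSolution n u₂ (Set.Ioc 0 T))
    (hc : 0 < c) (hcurv₂ : CurvCond n u₂ (Set.Ioc 0 T) c)
    (hinit₁ : TendstoLocallyUniformly (fun t x => u₁ x t) u₀ (nhdsWithin 0 (Set.Ioi 0)))
    (hinit₂ : TendstoLocallyUniformly (fun t x => u₂ x t) u₀ (nhdsWithin 0 (Set.Ioi 0)))
    (x : EuclideanSpace ℝ (Fin n)) {t : ℝ} (ht : t ∈ Set.Ioo 0 T) :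
    u₁ x t ≤ u₂ x t := by
  by_contra! hlt
  set w : EuclideanSpace ℝ (Fin n) → ℝ → ℝ := fun y s => exp (-u₂ y s) - exp (-u₁ y s) with hw
  set K := 2 * c + 2 with hK
  set F : EuclideanSpace ℝ (Fin n) → ℝ → ℝ := fun y s => exp (-K * s) * w y s with hF
  have hwpos : 0 < w x t := sub_pos.2 (exp_lt_exp.2 (by linarith))
  have hFpos : 0 < F x t := mul_pos (exp_pos _) hwpos
  have hFw : ∀ y, ∀ s, 0 < s → ∀ η > 0, w y s < η → F y s < η := by
    intro y s hs η hη h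
    have h1 : exp (-K * s) ≤ 1 := exp_le_one_iff.2 (by nlinarith)
    calc _ < exp (-K * s) * η := by simp only [hF]; gcongr
      _ ≤ 1 * η := by gcongr
      _ = η := one_mul η
  obtain ⟨B, hB, hBF⟩ := exists_compact_exp_neg_lt hproper (n * c * T) hFpos
  have hout : ∀ y ∉ B, ∀ s ∈ Ioo 0 T, F y s < F x t := by
    intro y hy s hs
    refine hFw y s hs.1 _ hFpos ?_
    have h1 := initial_sub_le hsmooth₂ hflow₂ hcurv₂ hinit₂ y hs
    have h2 : n * c * s ≤ n * c * T := by gcongr; exact hs.2.le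
    have h3 : exp (-u₂ y s) ≤ exp (-(u₀ y - n * c * T)) := exp_le_exp.2 (by linarith)
    linarith [hBF y hy, exp_pos (-u₁ y s)]
  obtain ⟨τ, hτ, hτF⟩ := exists_time_exp_neg_sub_lt hu₀ hinit₁ hinit₂ hB hFpos
  have hxB : x ∈ B := by
    by_contra h
    exact lt_irrefl _ (hout x h t ht)
  have hτt : τ ≤ t := by
    by_contra! h
    exact lt_irrefl _ (hFw x t ht.1 _ hFpos (hτF t ⟨ht.1, h⟩ x hxB))
  have hsub : B ×ˢ Icc τ t ⊆ (univ : Set (EuclideanSpace ℝ (Fin n))) ×ˢ Ioc 0 T :=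
    prod_mono (subset_univ B) fun s hs => ⟨hτ.trans_le hs.1, hs.2.trans ht.2.le⟩
  have hcont : ContinuousOn (fun p : EuclideanSpace ℝ (Fin n) × ℝ => F p.1 p.2)
      (B ×ˢ Icc τ t) := by
    have h1 := hsmooth₁.continuousOn.mono hsub
    have h2 := hsmooth₂.continuousOn.mono hsub
    simp only [hF, hw]
    fun_prop
  obtain ⟨⟨x₀, t₀⟩, ⟨hx₀, ht₀⟩, hmax⟩ :=
    (hB.prod isCompact_Icc).exists_isMaxOn ⟨(x, t), hxB, hτt, le_rfl⟩ hcont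
  have hFx₀ : F x t ≤ F x₀ t₀ := hmax ⟨hxB, hτt, le_rfl⟩
  have hglobal : ∀ y, ∀ s ∈ Ioc 0 t, F y s ≤ F x₀ t₀ := by
    intro y s hs
    by_cases hy : y ∈ B
    · rcases lt_or_ge s τ with h | h
      · exact (hFw y s hs.1 _ hFpos (hτF s ⟨hs.1, h⟩ y hy)).le.trans hFx₀
      · exact hmax (a := (y, s)) ⟨hy, h, hs.2⟩
    · exact (hout y hy s ⟨hs.1, hs.2.trans_lt ht.2⟩).le.trans hFx₀
  have ht₀' : t₀ ∈ Ioo 0 T := ⟨hτ.trans_le ht₀.1, ht₀.2.trans_lt ht.2⟩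
  have ht₀c := Ioo_subset_Ioc_self ht₀'
  have hwx₀ : 0 < w x₀ t₀ := pos_of_mul_pos_right (hFpos.trans_le hFx₀) (exp_pos _).le
  have hspace : IsLocalMax (fun y => exp (-u₂ y t₀) - exp (-u₁ y t₀)) x₀ :=
    Eventually.of_forall fun y =>
      le_of_mul_le_mul_left (hglobal y t₀ ⟨ht₀'.1, ht₀.2⟩) (exp_pos (-K * t₀))
  have hineq := exp_mul_mcfRHS_sub_le (contDiff_slice hsmooth₁ ht₀c) (contDiff_slice hsmooth₂ ht₀c)
    hc.le hspace (sub_pos.1 hwx₀).le (hcurv₂.hessian_grad_ge x₀ ht₀c)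
  have hdF : HasDerivAt (F x₀) _ t₀ :=
    (((hasDerivAt_id t₀).const_mul (-K)).exp).fun_mul
      ((hasDerivAt_time hsmooth₂ hflow₂ x₀ ht₀').fun_neg.exp.fun_sub
        (hasDerivAt_time hsmooth₁ hflow₁ x₀ ht₀').fun_neg.exp)
  have htime := hdF.nonneg_of_forall_left_le ht₀'.1 fun s hs =>
    hglobal x₀ s ⟨hs.1, hs.2.le.trans ht₀.2⟩
  simp only [id, mul_one] at htime
  have hwt : K * w x₀ t₀ ≤ exp (-u₁ x₀ t₀) * mcfRHS n (fun y => u₁ y t₀) x₀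
      - exp (-u₂ x₀ t₀) * mcfRHS n (fun y => u₂ y t₀) x₀ := by
    refine le_of_mul_le_mul_left ?_ (exp_pos (-K * t₀))
    simp only [hw]
    linarith
  simp only [hw] at hwt hwx₀
  rw [hK] at hwt
  linarith

end Flow

/-- **Theorem 1.4 (General uniqueness result for entire graphs).**
Let `u₀ : ℝⁿ → ℝ` be locally Lipschitz and proper (`u₀ x → +∞` as `|x| → +∞`).
Two smooth entire-graph solutions of graphical mean curvature flow on
`ℝⁿ × (0,T]` satisfying the curvature lower bound `v hⁱⱼ ≥ −c δⁱⱼ` with the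
same constant `c > 0`, and with the same initial data `u₀`, coincide. -/
theorem mcf_uniqueness_entire_graphs (n : ℕ) (T : ℝ) (hT : 0 < T)
    (u₀ : EuclideanSpace ℝ (Fin n) → ℝ)
    (hu₀ : LocallyLipschitz u₀)
    (hproper : Filter.Tendsto u₀ (Filter.cocompact _) Filter.atTop)
    (u₁ u₂ : EuclideanSpace ℝ (Fin n) → ℝ → ℝ)
    (hsmooth₁ : ContDiffOn ℝ (⊤ : ℕ∞) (fun p : EuclideanSpace ℝ (Fin n) × ℝ => u₁ p.1 p.2)
      (Set.univ ×ˢ Set.Ioc 0 T))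
    (hsmooth₂ : ContDiffOn ℝ (⊤ : ℕ∞) (fun p : EuclideanSpace ℝ (Fin n) × ℝ => u₂ p.1 p.2)
      (Set.univ ×ˢ Set.Ioc 0 T))
    (hflow₁ : IsMCFSolution n u₁ (Set.Ioc 0 T))
    (hflow₂ : IsMCFSolution n u₂ (Set.Ioc 0 T))
    (c : ℝ) (hc : 0 < c)
    (hcurv₁ : CurvCond n u₁ (Set.Ioc 0 T) c)
    (hcurv₂ : CurvCond n u₂ (Set.Ioc 0 T) c)
    (hinit₁ : TendstoLocallyUniformly (fun t x => u₁ x t) u₀ (nhdsWithin 0 (Set.Ioi 0)))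
    (hinit₂ : TendstoLocallyUniformly (fun t x => u₂ x t) u₀ (nhdsWithin 0 (Set.Ioi 0))) :
    ∀ x, ∀ t ∈ Set.Ioc 0 T, u₁ x t = u₂ x t := by
  have hIoo : ∀ x, ∀ t ∈ Set.Ioo 0 T, u₁ x t = u₂ x t := fun x t ht => le_antisymm
    (mcf_le_of_initial_eq hu₀.continuous hproper hsmooth₁ hsmooth₂ hflow₁ hflow₂ hc hcurv₂
      hinit₁ hinit₂ x ht)
    (mcf_le_of_initial_eq hu₀.continuous hproper hsmooth₂ hsmooth₁ hflow₂ hflow₁ hc hcurv₁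
      hinit₂ hinit₁ x ht)
  intro x t ht
  have hcont {u : EuclideanSpace ℝ (Fin n) → ℝ → ℝ}
      (hu : ContDiffOn ℝ (⊤ : ℕ∞) (fun p : EuclideanSpace ℝ (Fin n) × ℝ => u p.1 p.2)
        (Set.univ ×ˢ Set.Ioc 0 T)) : ContinuousOn (u x) (Set.Ioc 0 T) :=
    hu.continuousOn.comp (f := fun s => (x, s)) (by fun_prop) fun s hs => ⟨mem_univ x, hs⟩
  refine Set.EqOn.of_subset_closure (s := Set.Ioo 0 T) (fun s hs => hIoo x s hs)
    (hcont hsmooth₁) (hcont hsmooth₂) Set.Ioo_subset_Ioc_self ?_ ht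
  rw [closure_Ioo hT.ne]
  exact Set.Ioc_subset_Icc_self
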